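/- Let σ_D, σ_E > 0 and let σ_DE² = 1/(1/σ_D² + 1/σ_E²). Then lim_{A → 0⁺} ( C(A, σ_DE) − C(A, σ_E) ) / ( A²/(2σ_D²) ) = 1, where C(A, σ) denotes the capacity of the amplitude-constrained Gaussian channel with amplitude constraint A and noise standard deviation σ. -/

import Mathlib

open MeasureTheory ProbabilityTheory Real Filter Set
open scoped Classical

noncomputable section

/-- Kullback–Leibler divergence of `μ` from `ν` (valued in `EReal`; `⊤` when undefined). -/
def klDiv {α : Type*} [MeasurableSpace α] (μ ν : Measure α) : EReal :=
  if μ ≪ ν ∧ Integrable (llr μ ν) μ then ((∫ x, llr μ ν x ∂μ : ℝ) : EReal) else ⊤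

/-- Mutual information `I(U;V)` under `P`: the KL divergence of the joint law of `(U,V)`
from the product of its marginal laws. -/
def mutualInfo {Ω α β : Type*} [MeasurableSpace Ω] [MeasurableSpace α] [MeasurableSpace β]
    (P : Measure Ω) (U : Ω → α) (V : Ω → β) : EReal :=
  klDiv (P.map (fun ω => (U ω, V ω))) ((P.map U).prod (P.map V))

/-- Capacity of the amplitude-constrained Gaussian channel with amplitude constraint `A`
and noise standard deviation `σ`. -/
def gaussCap (A σ : ℝ) : EReal :=
  sSup {r : EReal | ∃ μ : Measure ℝ, IsProbabilityMeasure μ ∧ μ (Set.Icc (-A) A)ᶜ = 0 ∧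
    r = mutualInfo (μ.prod (gaussianReal 0 (σ ^ 2).toNNReal))
      (fun ω => ω.1) (fun ω => ω.1 + ω.2)}

/-- Density at `y` of `gaussianReal x v` with respect to `gaussianReal 0 v`. -/
def gaussRatio (v : NNReal) (x y : ℝ) : ℝ := exp ((x * y - x ^ 2 / 2) / v)

/-- Density at `y` of the output law of the channel with input law `μ` and noise variance `v`,
with respect to the noise law. -/
def mixRatio (μ : Measure ℝ) (v : NNReal) (y : ℝ) : ENNReal :=
  ∫⁻ x, ENNReal.ofReal (gaussRatio v x y) ∂μ

@[fun_prop]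
lemma measurable_gaussRatio (v : NNReal) : Measurable (fun p : ℝ × ℝ => gaussRatio v p.1 p.2) := by
  unfold gaussRatio; fun_prop

lemma gaussRatio_pos (v : NNReal) (x y : ℝ) : 0 < gaussRatio v x y := exp_pos _

lemma measurable_mixRatio (μ : Measure ℝ) [IsProbabilityMeasure μ] (v : NNReal) :
    Measurable (mixRatio μ v) := by
  unfold mixRatio
  exact Measurable.lintegral_prod_left' (measurable_gaussRatio v).ennreal_ofReal

lemma gaussianReal_eq_withDensity_gaussRatio {v : NNReal} (hv : v ≠ 0) (x : ℝ) :
    gaussianReal x v =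
      (gaussianReal 0 v).withDensity (fun y => ENNReal.ofReal (gaussRatio v x y)) := by
  have hm : Measurable (fun y => ENNReal.ofReal (gaussRatio v x y)) := by
    unfold gaussRatio; fun_prop
  rw [gaussianReal_of_var_ne_zero _ hv, gaussianReal_of_var_ne_zero _ hv,
    ← withDensity_mul _ (measurable_gaussianPDF 0 v) hm]
  congr 1
  ext y
  have hv' : (v : ℝ) ≠ 0 := by exact_mod_cast hv
  simp only [Pi.mul_apply, gaussianPDF]
  rw [← ENNReal.ofReal_mul (gaussianPDFReal_nonneg _ _ _)]
  congr 1
  simp only [gaussianPDFReal, gaussRatio]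
  rw [mul_assoc _ (exp _), ← exp_add]
  congr 2
  field_simp
  ring

lemma map_channel_eq_withDensity (μ : Measure ℝ) [IsProbabilityMeasure μ] {v : NNReal}
    (hv : v ≠ 0) :
    (μ.prod (gaussianReal 0 v)).map (fun ω => (ω.1, ω.1 + ω.2)) =
      (μ.prod (gaussianReal 0 v)).withDensity
        (fun p => ENNReal.ofReal (gaussRatio v p.1 p.2)) := by
  refine Measure.ext_of_lintegral _ fun f hf => ?_
  have hm := (measurable_gaussRatio v).ennreal_ofReal
  rw [lintegral_map hf (by fun_prop), lintegral_withDensity_eq_lintegral_mul _ hm hf,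
    lintegral_prod _ (by fun_prop), lintegral_prod _ (hm.mul hf).aemeasurable]
  refine lintegral_congr fun x => ?_
  have h1 : ∫⁻ y, f (x, x + y) ∂gaussianReal 0 v = ∫⁻ y, f (x, y) ∂gaussianReal x v := by
    have := gaussianReal_map_const_add (μ := 0) (v := v) x
    rw [zero_add] at this
    rw [← this, lintegral_map (by fun_prop) (by fun_prop)]
  rw [h1, gaussianReal_eq_withDensity_gaussRatio hv x,
    lintegral_withDensity_eq_lintegral_mul _ (by unfold gaussRatio; fun_prop) (by fun_prop)]
  rfl

lemma map_output_eq_withDensity (μ : Measure ℝ) [IsProbabilityMeasure μ] {v : NNReal}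
    (hv : v ≠ 0) :
    (μ.prod (gaussianReal 0 v)).map (fun ω => ω.1 + ω.2) =
      (gaussianReal 0 v).withDensity (mixRatio μ v) := by
  have hm := (measurable_gaussRatio v).ennreal_ofReal
  have h1 : (μ.prod (gaussianReal 0 v)).map (fun ω => ω.1 + ω.2) =
      ((μ.prod (gaussianReal 0 v)).map (fun ω => (ω.1, ω.1 + ω.2))).map Prod.snd := by
    rw [Measure.map_map (by fun_prop) (by fun_prop)]; rfl
  rw [h1, map_channel_eq_withDensity μ hv]
  refine Measure.ext_of_lintegral _ fun f hf => ?_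
  rw [lintegral_map hf measurable_snd, lintegral_withDensity_eq_lintegral_mul _ hm (by fun_prop),
    lintegral_prod_symm _ (hm.mul (by fun_prop)).aemeasurable,
    lintegral_withDensity_eq_lintegral_mul _ (measurable_mixRatio μ v) hf]
  refine lintegral_congr fun y => ?_
  simp only [Pi.mul_apply, mixRatio]
  rw [lintegral_mul_const _ (by unfold gaussRatio; fun_prop)]

lemma mixRatio_le (μ : Measure ℝ) [IsProbabilityMeasure μ] {v : NNReal} (hv : v ≠ 0) (y : ℝ) :
    mixRatio μ v y ≤ ENNReal.ofReal (exp (y ^ 2 / 2 / v)) := by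
  have hv' : (0 : ℝ) < v := by exact_mod_cast pos_iff_ne_zero.mpr hv
  calc mixRatio μ v y ≤ ∫⁻ _, ENNReal.ofReal (exp (y ^ 2 / 2 / v)) ∂μ := by
        refine lintegral_mono fun x => ENNReal.ofReal_le_ofReal (exp_le_exp.mpr ?_)
        gcongr
        nlinarith [sq_nonneg (x - y)]
    _ = _ := by simp

lemma mixRatio_ne_top (μ : Measure ℝ) [IsProbabilityMeasure μ] {v : NNReal} (hv : v ≠ 0) (y : ℝ) :
    mixRatio μ v y ≠ ⊤ :=
  ne_top_of_le_ne_top ENNReal.ofReal_ne_top (mixRatio_le μ hv y)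

lemma le_mixRatio {μ : Measure ℝ} [IsProbabilityMeasure μ] {v : NNReal} (hv : v ≠ 0) {A : ℝ}
    (hμ : ∀ᵐ x ∂μ, x ^ 2 ≤ A ^ 2) (y : ℝ) :
    ENNReal.ofReal (exp (-(y ^ 2 / 2 + A ^ 2) / v)) ≤ mixRatio μ v y := by
  have hv' : (0 : ℝ) < v := by exact_mod_cast pos_iff_ne_zero.mpr hv
  calc ENNReal.ofReal (exp (-(y ^ 2 / 2 + A ^ 2) / v))
      = ∫⁻ _, ENNReal.ofReal (exp (-(y ^ 2 / 2 + A ^ 2) / v)) ∂μ := by simp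
    _ ≤ mixRatio μ v y := by
        refine lintegral_mono_ae ?_
        filter_upwards [hμ] with x hx
        refine ENNReal.ofReal_le_ofReal (exp_le_exp.mpr ?_)
        gcongr
        nlinarith [sq_nonneg (x + y)]

lemma mixRatio_ne_zero {μ : Measure ℝ} [IsProbabilityMeasure μ] {v : NNReal} (hv : v ≠ 0) {A : ℝ}
    (hμ : ∀ᵐ x ∂μ, x ^ 2 ≤ A ^ 2) (y : ℝ) : mixRatio μ v y ≠ 0 :=
  ((ENNReal.ofReal_pos.mpr (exp_pos _)).trans_le (le_mixRatio hv hμ y)).ne'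

lemma toReal_mixRatio_pos {μ : Measure ℝ} [IsProbabilityMeasure μ] {v : NNReal} (hv : v ≠ 0)
    {A : ℝ} (hμ : ∀ᵐ x ∂μ, x ^ 2 ≤ A ^ 2) (y : ℝ) : 0 < (mixRatio μ v y).toReal :=
  ENNReal.toReal_pos (mixRatio_ne_zero hv hμ y) (mixRatio_ne_top μ hv y)

lemma log_toReal_le_of_le_ofReal_exp {a : ENNReal} {c : ℝ} (h0 : 0 < a.toReal)
    (h : a ≤ ENNReal.ofReal (exp c)) : log a.toReal ≤ c := by
  rw [log_le_iff_le_exp h0]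
  exact ENNReal.toReal_le_of_le_ofReal (exp_pos _).le h

lemma abs_log_mixRatio_le {μ : Measure ℝ} [IsProbabilityMeasure μ] {v : NNReal} (hv : v ≠ 0)
    {A : ℝ} (hμ : ∀ᵐ x ∂μ, x ^ 2 ≤ A ^ 2) (y : ℝ) :
    |log (mixRatio μ v y).toReal| ≤ (y ^ 2 + A ^ 2) / v := by
  have hv' : (0 : ℝ) < v := by exact_mod_cast pos_iff_ne_zero.mpr hv
  have hp := toReal_mixRatio_pos hv hμ y
  rw [abs_le]
  constructor
  · rw [le_log_iff_exp_le hp]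
    have h1 := (ENNReal.ofReal_le_iff_le_toReal (mixRatio_ne_top μ hv y)).mp (le_mixRatio hv hμ y)
    refine le_trans (exp_le_exp.mpr ?_) h1
    rw [← neg_div]
    gcongr
    nlinarith [sq_nonneg y]
  · refine (log_toReal_le_of_le_ofReal_exp hp (mixRatio_le μ hv y)).trans ?_
    gcongr
    nlinarith [sq_nonneg y, sq_nonneg A]

section Moments

variable {μ : Measure ℝ} [IsProbabilityMeasure μ] {A : ℝ}

lemma integrable_sq_input (hμ : ∀ᵐ x ∂μ, x ^ 2 ≤ A ^ 2) : Integrable (fun x => x ^ 2) μ := by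
  refine Integrable.mono' (integrable_const (A ^ 2)) (by fun_prop) ?_
  filter_upwards [hμ] with x hx
  rwa [norm_of_nonneg (sq_nonneg x)]

lemma integrable_input (hμ : ∀ᵐ x ∂μ, x ^ 2 ≤ A ^ 2) : Integrable (fun x : ℝ => x) μ := by
  refine Integrable.mono' (integrable_const |A|) (by fun_prop) ?_
  filter_upwards [hμ] with x hx
  exact sq_le_sq.mp hx

lemma integrable_sq_gaussianReal (m : ℝ) (v : NNReal) :
    Integrable (fun x => x ^ 2) (gaussianReal m v) :=
  (memLp_id_gaussianReal 2).integrable_sq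

lemma integrable_id_gaussianReal (m : ℝ) (v : NNReal) :
    Integrable (fun x : ℝ => x) (gaussianReal m v) :=
  memLp_one_iff_integrable.mp (memLp_id_gaussianReal 1)

lemma integral_sq_gaussianReal (v : NNReal) : ∫ x, x ^ 2 ∂gaussianReal 0 v = v := by
  have h := variance_id_gaussianReal (μ := 0) (v := v)
  rwa [variance_of_integral_eq_zero (by fun_prop) (by simp)] at h

lemma integrable_sq_output (hμ : ∀ᵐ x ∂μ, x ^ 2 ≤ A ^ 2) (v : NNReal) :
    Integrable (fun p : ℝ × ℝ => (p.1 + p.2) ^ 2) (μ.prod (gaussianReal 0 v)) := by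
  have h1 := (integrable_sq_input hμ).comp_fst (gaussianReal 0 v)
  have h2 := (integrable_input hμ).mul_prod (integrable_id_gaussianReal 0 v)
  have h3 := (integrable_sq_gaussianReal 0 v).comp_snd μ
  refine ((h1.add (h2.const_mul 2)).add h3).congr (ae_of_all _ fun p => ?_)
  simp only [Pi.add_apply]
  ring

lemma integral_mul_noise (v : NNReal) : ∫ p : ℝ × ℝ, p.1 * p.2 ∂μ.prod (gaussianReal 0 v) = 0 := by
  rw [integral_prod_mul (fun x : ℝ => x) (fun x : ℝ => x), integral_id_gaussianReal, mul_zero]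

lemma integral_sq_output (hμ : ∀ᵐ x ∂μ, x ^ 2 ≤ A ^ 2) (v : NNReal) :
    ∫ p : ℝ × ℝ, (p.1 + p.2) ^ 2 ∂μ.prod (gaussianReal 0 v) = ∫ x, x ^ 2 ∂μ + v := by
  have h1 := (integrable_sq_input hμ).comp_fst (gaussianReal 0 v)
  have h2 := (integrable_input hμ).mul_prod (integrable_id_gaussianReal 0 v)
  have h3 := (integrable_sq_gaussianReal 0 v).comp_snd μ
  calc ∫ p : ℝ × ℝ, (p.1 + p.2) ^ 2 ∂μ.prod (gaussianReal 0 v)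
      = ∫ p : ℝ × ℝ, (p.1 ^ 2 + 2 * (p.1 * p.2) + p.2 ^ 2) ∂μ.prod (gaussianReal 0 v) := by
        congr 1; ext p; ring
    _ = _ := by
        rw [integral_add (f := fun p : ℝ × ℝ => p.1 ^ 2 + 2 * (p.1 * p.2)) (h1.add (h2.const_mul 2)) h3,
          integral_add h1 (h2.const_mul 2),
          integral_const_mul, integral_mul_noise,
          integral_fun_fst (fun x : ℝ => x ^ 2), integral_fun_snd (fun x : ℝ => x ^ 2),
          integral_sq_gaussianReal]
        simp

lemma integrable_log_mixRatio (hμ : ∀ᵐ x ∂μ, x ^ 2 ≤ A ^ 2) {v : NNReal} (hv : v ≠ 0) :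
    Integrable (fun p : ℝ × ℝ => log (mixRatio μ v (p.1 + p.2)).toReal)
      (μ.prod (gaussianReal 0 v)) := by
  have hm := measurable_mixRatio μ v
  refine Integrable.mono' (((integrable_sq_output hμ v).add
    (integrable_const (A ^ 2))).div_const (v : ℝ))
    (Measurable.aestronglyMeasurable (by fun_prop)) (ae_of_all _ fun p => ?_)
  exact abs_log_mixRatio_le hv hμ _

lemma integral_log_gaussRatio (hμ : ∀ᵐ x ∂μ, x ^ 2 ≤ A ^ 2) (v : NNReal) :
    Integrable (fun p : ℝ × ℝ => log (gaussRatio v p.1 (p.1 + p.2))) (μ.prod (gaussianReal 0 v)) ∧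
    ∫ p : ℝ × ℝ, log (gaussRatio v p.1 (p.1 + p.2)) ∂μ.prod (gaussianReal 0 v) =
      (∫ x, x ^ 2 ∂μ) / (2 * v) := by
  have h1 := ((integrable_sq_input hμ).comp_fst (gaussianReal 0 v)).div_const (2 * (v : ℝ))
  have h2 := ((integrable_input hμ).mul_prod (integrable_id_gaussianReal 0 v)).div_const (v : ℝ)
  have he : (fun p : ℝ × ℝ => log (gaussRatio v p.1 (p.1 + p.2))) =
      fun p => p.1 ^ 2 / (2 * (v : ℝ)) + p.1 * p.2 / v := by
    ext p
    rw [gaussRatio, log_exp]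
    ring
  rw [he]
  refine ⟨h1.add h2, ?_⟩
  rw [integral_add h1 h2, integral_div, integral_div, integral_mul_noise,
    integral_fun_fst (fun x : ℝ => x ^ 2)]
  simp

lemma mutualInfo_channel_eq (hμ : ∀ᵐ x ∂μ, x ^ 2 ≤ A ^ 2) {v : NNReal} (hv : v ≠ 0) :
    mutualInfo (μ.prod (gaussianReal 0 v)) (fun ω => ω.1) (fun ω => ω.1 + ω.2) =
      (((∫ x, x ^ 2 ∂μ) / (2 * v) -
        ∫ p : ℝ × ℝ, log (mixRatio μ v (p.1 + p.2)).toReal ∂μ.prod (gaussianReal 0 v) : ℝ) :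
        EReal) := by
  set Q := gaussianReal 0 v with hQ
  have hm := measurable_mixRatio μ v
  have ha := (measurable_gaussRatio v).ennreal_ofReal
  set J := (μ.prod Q).map (fun ω => (ω.1, ω.1 + ω.2)) with hJ
  set ν := ((μ.prod Q).map (fun ω => ω.1)).prod ((μ.prod Q).map (fun ω => ω.1 + ω.2)) with hν
  have hprob : IsProbabilityMeasure ((μ.prod Q).map (fun ω : ℝ × ℝ => ω.1 + ω.2)) :=
    Measure.isProbabilityMeasure_map (by fun_prop)
  have hfst : (μ.prod Q).map (fun ω : ℝ × ℝ => ω.1) = μ := by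
    have := Measure.map_fst_prod (μ := μ) (ν := Q)
    rwa [measure_univ, one_smul] at this
  have hν' : ν = (μ.prod Q).withDensity (fun p => mixRatio μ v p.2) := by
    rw [map_output_eq_withDensity μ hv] at hprob
    rw [hν, hfst, map_output_eq_withDensity μ hv, prod_withDensity_right hm]
  set r : ℝ × ℝ → ENNReal :=
    fun p => (mixRatio μ v p.2)⁻¹ * ENNReal.ofReal (gaussRatio v p.1 p.2) with hr
  have hrm : Measurable r := by fun_prop
  have hJν : J = ν.withDensity r := by
    rw [hJ, map_channel_eq_withDensity μ hv, hν', ← withDensity_mul _ (by fun_prop) hrm]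
    congr 1
    ext p
    simp only [Pi.mul_apply, hr]
    rw [← mul_assoc, ENNReal.mul_inv_cancel (mixRatio_ne_zero hv hμ _) (mixRatio_ne_top μ hv _),
      one_mul]
  have hνp : IsProbabilityMeasure ν := by rw [hν, hfst]; infer_instance
  have hac : J ≪ ν := hJν ▸ withDensity_absolutelyContinuous _ _
  have hllr : llr J ν =ᵐ[J]
      fun p => log (gaussRatio v p.1 p.2) - log (mixRatio μ v p.2).toReal := by
    have h := Measure.rnDeriv_withDensity ν hrm
    rw [← hJν] at h
    filter_upwards [hac.ae_le h] with p hp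
    rw [llr, hp, hr]
    simp only [ENNReal.toReal_mul, ENNReal.toReal_inv,
      ENNReal.toReal_ofReal (gaussRatio_pos v p.1 p.2).le]
    rw [log_mul (inv_ne_zero (toReal_mixRatio_pos hv hμ _).ne') (gaussRatio_pos _ _ _).ne', log_inv]
    ring
  obtain ⟨hi1, he1⟩ := integral_log_gaussRatio hμ v
  have hi2 := integrable_log_mixRatio hμ hv
  have hgm : Measurable
      (fun p : ℝ × ℝ => log (gaussRatio v p.1 p.2) - log (mixRatio μ v p.2).toReal) := by
    fun_prop
  have hint : Integrable (llr J ν) J := by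
    rw [integrable_congr hllr, hJ, integrable_map_measure hgm.aestronglyMeasurable (by fun_prop)]
    exact hi1.sub hi2
  rw [mutualInfo, klDiv, if_pos ⟨hac, hint⟩]
  congr 1
  rw [← hJ, ← hν, integral_congr_ae hllr, hJ,
    integral_map (by fun_prop) hgm.aestronglyMeasurable]
  rw [integral_sub hi1 hi2, he1]

lemma integral_log_mixRatio_nonneg (hμ : ∀ᵐ x ∂μ, x ^ 2 ≤ A ^ 2) {v : NNReal} (hv : v ≠ 0) :
    0 ≤ ∫ p : ℝ × ℝ, log (mixRatio μ v (p.1 + p.2)).toReal ∂μ.prod (gaussianReal 0 v) := by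
  have hm := measurable_mixRatio μ v
  have hlog : Measurable fun y => log (mixRatio μ v y).toReal := by fun_prop
  have hadd : AEMeasurable (fun p : ℝ × ℝ => p.1 + p.2) (μ.prod (gaussianReal 0 v)) := by fun_prop
  have hi := integrable_log_mixRatio hμ hv
  have hlt : ∀ᵐ y ∂gaussianReal 0 v, mixRatio μ v y < ⊤ :=
    ae_of_all _ fun y => (mixRatio_ne_top μ hv y).lt_top
  rw [← integral_map (f := fun y => log (mixRatio μ v y).toReal) hadd hlog.aestronglyMeasurable]
  have hi' : Integrable (fun y => log (mixRatio μ v y).toReal)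
      ((μ.prod (gaussianReal 0 v)).map (fun p => p.1 + p.2)) := by
    rw [integrable_map_measure hlog.aestronglyMeasurable hadd]; exact hi
  set ρ := (μ.prod (gaussianReal 0 v)).map (fun p : ℝ × ℝ => p.1 + p.2) with hρ
  have hρp : IsProbabilityMeasure ρ := Measure.isProbabilityMeasure_map hadd
  have hρd : ρ = _ := map_output_eq_withDensity μ hv
  have hone : ∀ y, (mixRatio μ v y).toReal • (mixRatio μ v y).toReal⁻¹ = 1 := fun y =>
    mul_inv_cancel₀ (toReal_mixRatio_pos hv hμ y).ne'
  have hinv : Integrable (fun y => (mixRatio μ v y).toReal⁻¹) ρ := by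
    rw [hρd, integrable_withDensity_iff_integrable_smul' hm hlt]
    simp only [hone]
    exact integrable_const 1
  have hinv1 : ∫ y, (mixRatio μ v y).toReal⁻¹ ∂ρ = 1 := by
    rw [hρd, integral_withDensity_eq_integral_toReal_smul hm hlt]
    simp only [hone]
    simp
  calc (0 : ℝ) = ∫ y, (1 - (mixRatio μ v y).toReal⁻¹) ∂ρ := by
        rw [integral_sub (integrable_const 1) hinv, hinv1]; simp
    _ ≤ _ := integral_mono ((integrable_const 1).sub hinv) hi' fun y =>
        one_sub_inv_le_log_of_pos (toReal_mixRatio_pos hv hμ y)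

end Moments

lemma gaussCap_le {A : ℝ} {σ : ℝ} (hσ : 0 < σ) :
    gaussCap A σ ≤ ((A ^ 2 / (2 * σ ^ 2) : ℝ) : EReal) := by
  refine sSup_le ?_
  rintro r ⟨μ, hp, hμ, rfl⟩
  have hv : (σ ^ 2).toNNReal ≠ 0 := (Real.toNNReal_pos.mpr (by positivity)).ne'
  have hμ' : ∀ᵐ x ∂μ, x ^ 2 ≤ A ^ 2 := by
    have : ∀ᵐ x ∂μ, x ∈ Set.Icc (-A) A := hμ
    filter_upwards [this] with x hx
    exact sq_le_sq' hx.1 hx.2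
  rw [mutualInfo_channel_eq hμ' hv, EReal.coe_le_coe_iff, Real.coe_toNNReal _ (sq_nonneg σ)]
  have h1 := integral_log_mixRatio_nonneg hμ' hv
  have h2 : ∫ x, x ^ 2 ∂μ ≤ A ^ 2 := by
    calc ∫ x, x ^ 2 ∂μ ≤ ∫ _, A ^ 2 ∂μ :=
          integral_mono_ae (integrable_sq_input hμ') (integrable_const _) hμ'
      _ = A ^ 2 := by simp
  have h3 : (∫ x, x ^ 2 ∂μ) / (2 * σ ^ 2) ≤ A ^ 2 / (2 * σ ^ 2) := by gcongr
  linarith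

/-- The uniform law on `{-A, A}`. -/
def twoPoint (A : ℝ) : Measure ℝ :=
  (2⁻¹ : ENNReal) • Measure.dirac A + (2⁻¹ : ENNReal) • Measure.dirac (-A)

instance (A : ℝ) : IsProbabilityMeasure (twoPoint A) :=
  ⟨by simp [twoPoint, ENNReal.inv_two_add_inv_two]⟩

lemma mixRatio_twoPoint_le {v : NNReal} (A y : ℝ) :
    mixRatio (twoPoint A) v y ≤
      ENNReal.ofReal (exp (-A ^ 2 / (2 * v) + A ^ 2 / (2 * v ^ 2) * y ^ 2)) := by
  have h2 : (2⁻¹ : ENNReal) = ENNReal.ofReal 2⁻¹ := by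
    rw [ENNReal.ofReal_inv_of_pos (by norm_num)]; simp
  rw [mixRatio, twoPoint, lintegral_add_measure, lintegral_smul_measure, lintegral_smul_measure,
    lintegral_dirac, lintegral_dirac, smul_eq_mul, smul_eq_mul, h2,
    ← ENNReal.ofReal_mul (by norm_num), ← ENNReal.ofReal_mul (by norm_num),
    ← ENNReal.ofReal_add (by have := gaussRatio_pos v A y; positivity)
      (by have := gaussRatio_pos v (-A) y; positivity)]
  refine ENNReal.ofReal_le_ofReal ?_
  calc 2⁻¹ * gaussRatio v A y + 2⁻¹ * gaussRatio v (-A) y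
      = exp (-A ^ 2 / (2 * v)) * cosh (A * y / v) := by
        have e1 : (A * y - A ^ 2 / 2) / (v : ℝ) = -A ^ 2 / (2 * v) + A * y / v := by
          rw [← div_div]; ring
        have e2 : (-A * y - (-A) ^ 2 / 2) / (v : ℝ) = -A ^ 2 / (2 * v) + -(A * y / v) := by
          rw [← div_div]; ring
        rw [gaussRatio, gaussRatio, e1, e2, exp_add, exp_add, cosh_eq]
        ring
    _ ≤ exp (-A ^ 2 / (2 * v)) * exp ((A * y / v) ^ 2 / 2) := by
        gcongr; exact cosh_le_exp_half_sq _
    _ = _ := by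
        rw [← exp_add]
        congr 2
        rw [mul_comm (2 : ℝ), ← div_div]
        ring

lemma le_gaussCap {A : ℝ} (hA : 0 ≤ A) {σ : ℝ} (hσ : 0 < σ) :
    ((A ^ 2 / (2 * σ ^ 2) - A ^ 4 / (2 * σ ^ 4) : ℝ) : EReal) ≤ gaussCap A σ := by
  have hv : (σ ^ 2).toNNReal ≠ 0 := (Real.toNNReal_pos.mpr (by positivity)).ne'
  have hsupp : twoPoint A (Set.Icc (-A) A)ᶜ = 0 := by
    simp [twoPoint, hA]
  have hμ' : ∀ᵐ x ∂twoPoint A, x ^ 2 ≤ A ^ 2 := by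
    have : ∀ᵐ x ∂twoPoint A, x ∈ Set.Icc (-A) A := hsupp
    filter_upwards [this] with x hx
    exact sq_le_sq' hx.1 hx.2
  refine le_trans ?_ (le_sSup ⟨twoPoint A, inferInstance, hsupp, rfl⟩)
  set v := (σ ^ 2).toNNReal
  have hvσ : (v : ℝ) = σ ^ 2 := Real.coe_toNNReal _ (sq_nonneg σ)
  rw [mutualInfo_channel_eq hμ' hv, EReal.coe_le_coe_iff]
  have h2 : ∫ x, x ^ 2 ∂twoPoint A = A ^ 2 := by
    rw [twoPoint, integral_add_measure, integral_smul_measure, integral_smul_measure,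
      integral_dirac, integral_dirac]
    · simp only [ENNReal.toReal_inv, ENNReal.toReal_ofNat, smul_eq_mul]; ring
    · exact (integrable_dirac (by simp)).smul_measure (by simp)
    · exact (integrable_dirac (by simp)).smul_measure (by simp)
  have hb := (integrable_sq_output hμ' v).const_mul (A ^ 2 / (2 * (v : ℝ) ^ 2))
  have h3 : ∫ p : ℝ × ℝ, log (mixRatio (twoPoint A) v (p.1 + p.2)).toReal
      ∂(twoPoint A).prod (gaussianReal 0 v) ≤
      -A ^ 2 / (2 * v) + A ^ 2 / (2 * v ^ 2) * (A ^ 2 + v) := by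
    calc _ ≤ ∫ p : ℝ × ℝ, (-A ^ 2 / (2 * v) + A ^ 2 / (2 * v ^ 2) * (p.1 + p.2) ^ 2)
          ∂(twoPoint A).prod (gaussianReal 0 v) :=
          integral_mono (integrable_log_mixRatio hμ' hv) ((integrable_const _).add hb) fun p =>
            log_toReal_le_of_le_ofReal_exp (toReal_mixRatio_pos hv hμ' _)
              (mixRatio_twoPoint_le A _)
      _ = _ := by
          rw [integral_add (integrable_const _) hb, integral_const_mul, integral_sq_output hμ', h2]
          simp
  rw [h2]
  rw [hvσ] at h3 ⊢
  have h4 : -A ^ 2 / (2 * σ ^ 2) + A ^ 2 / (2 * (σ ^ 2) ^ 2) * (A ^ 2 + σ ^ 2) =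
      A ^ 4 / (2 * σ ^ 4) := by
    field_simp; ring
  linarith

lemma exists_gaussCap_eq {A : ℝ} (hA : 0 ≤ A) {σ : ℝ} (hσ : 0 < σ) :
    ∃ c : ℝ, gaussCap A σ = c ∧ c ≤ A ^ 2 / (2 * σ ^ 2) ∧
      A ^ 2 / (2 * σ ^ 2) - A ^ 4 / (2 * σ ^ 4) ≤ c := by
  have h1 := gaussCap_le (A := A) hσ
  have h2 := le_gaussCap hA hσ
  have ht : gaussCap A σ ≠ ⊤ := ne_top_of_le_ne_top (EReal.coe_ne_top _) h1
  have hb : gaussCap A σ ≠ ⊥ := ne_bot_of_le_ne_bot (EReal.coe_ne_bot _) h2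
  lift gaussCap A σ to ℝ using ⟨ht, hb⟩ with c
  exact ⟨c, rfl, EReal.coe_le_coe_iff.mp h1, EReal.coe_le_coe_iff.mp h2⟩

/-- With `σ_DE² = 1/(1/σ_D² + 1/σ_E²)`,
`(C(A, σ_DE) − C(A, σ_E)) / (A²/(2σ_D²)) → 1` as `A → 0⁺`. -/
theorem stmt19 (σD σE : ℝ) (hσD : 0 < σD) (hσE : 0 < σE) :
    Tendsto (fun A =>
        (gaussCap A (Real.sqrt (1 / (1 / σD ^ 2 + 1 / σE ^ 2))) - gaussCap A σE) /
          ((A ^ 2 / (2 * σD ^ 2) : ℝ) : EReal))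
      (nhdsWithin 0 (Set.Ioi 0)) (nhds 1) := by
  set s := Real.sqrt (1 / (1 / σD ^ 2 + 1 / σE ^ 2)) with hs
  have hs0 : 0 < s := by positivity
  have hs2 : 1 / s ^ 2 = 1 / σD ^ 2 + 1 / σE ^ 2 := by
    rw [hs, Real.sq_sqrt (by positivity), one_div_one_div]
  have key : Tendsto (fun A => (((gaussCap A s).toReal - (gaussCap A σE).toReal) /
      (A ^ 2 / (2 * σD ^ 2)) : ℝ)) (nhdsWithin 0 (Set.Ioi 0)) (nhds 1) := by
    have hlim : ∀ c : ℝ, Tendsto (fun A : ℝ => 1 + c * A ^ 2) (nhdsWithin 0 (Set.Ioi 0))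
        (nhds 1) := fun c => by
      have : Continuous (fun A : ℝ => 1 + c * A ^ 2) := by fun_prop
      simpa using (this.tendsto 0).mono_left nhdsWithin_le_nhds
    refine tendsto_of_tendsto_of_tendsto_of_le_of_le' (hlim (-(σD ^ 2 / s ^ 4)))
      (hlim (σD ^ 2 / σE ^ 4)) ?_ ?_
    all_goals
      filter_upwards [self_mem_nhdsWithin] with A hA
      have hA : 0 < A := hA
      obtain ⟨c, hc, hc1, hc2⟩ := exists_gaussCap_eq hA.le hs0
      obtain ⟨d, hd, hd1, hd2⟩ := exists_gaussCap_eq hA.le hσE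
      have he : A ^ 2 / (2 * s ^ 2) = A ^ 2 / (2 * σD ^ 2) + A ^ 2 / (2 * σE ^ 2) := by
        have : A ^ 2 / (2 * s ^ 2) = A ^ 2 / 2 * (1 / s ^ 2) := by ring
        rw [this, hs2]; ring
      rw [hc, hd, EReal.toReal_coe, EReal.toReal_coe]
    · rw [le_div_iff₀ (by positivity)]
      have : (1 + -(σD ^ 2 / s ^ 4) * A ^ 2) * (A ^ 2 / (2 * σD ^ 2)) =
          A ^ 2 / (2 * σD ^ 2) - A ^ 4 / (2 * s ^ 4) := by
        field_simp
        ring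
      linarith
    · rw [div_le_iff₀ (by positivity)]
      have : (1 + σD ^ 2 / σE ^ 4 * A ^ 2) * (A ^ 2 / (2 * σD ^ 2)) =
          A ^ 2 / (2 * σD ^ 2) + A ^ 4 / (2 * σE ^ 4) := by
        field_simp
      linarith
  have key' := (continuous_coe_real_ereal.tendsto 1).comp key
  refine key'.congr' ?_
  filter_upwards [self_mem_nhdsWithin] with A hA
  have hA : 0 < A := hA
  obtain ⟨c, hc, -⟩ := exists_gaussCap_eq hA.le hs0
  obtain ⟨d, hd, -⟩ := exists_gaussCap_eq hA.le hσE
  simp only [Function.comp_apply, hc, hd, EReal.toReal_coe, EReal.coe_div, EReal.coe_sub]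

end
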